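/- Let S be the set of five points on the unit circle in ℝ² with polar angles (in degrees) 17.37, 96.22, 174.42, 219.75 and 299.27, i.e. the points (cos θ, sin θ) for these angles θ. Then every wake-up tree for S rooted at the origin, with edge lengths measured by the Euclidean norm on ℝ², has makespan at least 3.52. In particular, the optimal makespan of this instance exceeds 3.351, the optimal makespan for five points equally spaced on the unit circle. -/

import Mathlib

/-- `IsWakeUpTree d p₀ S parent t` : `parent` encodes a rooted spanning tree on the node
node set `{p₀} ∪ S` (each non-root node has a parent among the nodes and reaches the root
by iterating `parent`), the root `p₀` has exactly one child (when there is a non-root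
node), every non-root node has at most two children, and `t v` is the sum of the
`d`-distances along the tree path from `p₀` to `v` (so the makespan of the tree is the
maximum of `t` over the nodes). -/
def IsWakeUpTree {X : Type*} (d : X → X → ℝ) (p₀ : X) (S : Finset X)
    (parent : X → X) (t : X → ℝ) : Prop :=
  t p₀ = 0 ∧
  (∀ p ∈ S, p ≠ p₀ →
      (parent p = p₀ ∨ parent p ∈ S) ∧
      t p = t (parent p) + d (parent p) p ∧
      ∃ n : ℕ, parent^[n] p = p₀) ∧
  -- the root has at most one child
  (∀ x ∈ S, x ≠ p₀ → parent x = p₀ →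
      ∀ y ∈ S, y ≠ p₀ → parent y = p₀ → x = y) ∧
  -- the root has a child as soon as there is a non-root node
  ((∃ p ∈ S, p ≠ p₀) → ∃ c ∈ S, c ≠ p₀ ∧ parent c = p₀) ∧
  -- every non-root node has at most two children
  (∀ q ∈ S, q ≠ p₀ → ∀ x ∈ S, ∀ y ∈ S, ∀ z ∈ S,
      x ≠ p₀ → y ≠ p₀ → z ≠ p₀ →
      parent x = q → parent y = q → parent z = q →
      x = y ∨ x = z ∨ y = z)

open scoped Classical

/-- The point of `ℝ²` (with the Euclidean norm) with coordinates `(a, b)`. -/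
noncomputable def pt2 (a b : ℝ) : EuclideanSpace ℝ (Fin 2) :=
  (WithLp.equiv 2 (Fin 2 → ℝ)).symm ![a, b]

/-- The point of the unit circle with polar angle of `θ` degrees. -/
noncomputable def unitCirclePtDeg (θ : ℝ) : EuclideanSpace ℝ (Fin 2) :=
  pt2 (Real.cos (θ * Real.pi / 180)) (Real.sin (θ * Real.pi / 180))

/-- The five-point instance with polar angles `17.37°, 96.22°, 174.42°, 219.75°, 299.27°`. -/
noncomputable def fivePointInstance : Finset (EuclideanSpace ℝ (Fin 2)) :=
  {unitCirclePtDeg 17.37, unitCirclePtDeg 96.22, unitCirclePtDeg 174.42,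
    unitCirclePtDeg 219.75, unitCirclePtDeg 299.27}

open Real in
theorem unitCirclePtDeg_dist_sq (a b : ℝ) :
    dist (unitCirclePtDeg a) (unitCirclePtDeg b) ^ 2 = 2 - 2 * cos ((b - a) * π / 180) := by
  rw [EuclideanSpace.dist_sq_eq, Fin.sum_univ_two]
  simp only [unitCirclePtDeg, pt2, WithLp.equiv_symm_apply, Matrix.cons_val_zero,
    Matrix.cons_val_one, Real.dist_eq, sq_abs]
  rw [show (b - a) * π / 180 = b * π / 180 - a * π / 180 by ring, cos_sub]
  nlinarith [sin_sq_add_cos_sq (a * π / 180), sin_sq_add_cos_sq (b * π / 180)]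

theorem unitCirclePtDeg_dist_zero (a : ℝ) :
    dist (0 : EuclideanSpace ℝ (Fin 2)) (unitCirclePtDeg a) = 1 := by
  have h : dist (0 : EuclideanSpace ℝ (Fin 2)) (unitCirclePtDeg a) ^ 2 = 1 := by
    rw [EuclideanSpace.dist_sq_eq, Fin.sum_univ_two]
    simp [unitCirclePtDeg, pt2, Real.dist_eq]
  exact (pow_eq_one_iff_of_nonneg dist_nonneg two_ne_zero).1 h

theorem unitCirclePtDeg_ne_zero (a : ℝ) : unitCirclePtDeg a ≠ 0 := by
  intro h
  simpa [h] using unitCirclePtDeg_dist_zero a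

open Real in
/-- Two points of the unit circle separated by an angle of at least `δ` degrees on both sides
are at least as far apart as the chord spanned by `δ`. -/
theorem le_unitCirclePtDeg_dist {a b δ c r : ℝ} (hδ : 0 ≤ δ) (h₁ : δ ≤ b - a)
    (h₂ : b - a ≤ 360 - δ) (hc : cos (δ * π / 180) ≤ c) (hr : r ^ 2 ≤ 2 - 2 * c) :
    r ≤ dist (unitCirclePtDeg a) (unitCirclePtDeg b) := by
  refine le_of_sq_le_sq ?_ dist_nonneg
  rw [unitCirclePtDeg_dist_sq]
  suffices cos ((b - a) * π / 180) ≤ cos (δ * π / 180) by linarith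
  rcases le_total (b - a) 180 with h | h
  · apply cos_le_cos_of_nonneg_of_le_pi <;> nlinarith [pi_pos]
  · rw [← cos_two_pi_sub]
    apply cos_le_cos_of_nonneg_of_le_pi <;> nlinarith [pi_pos]

open Real in
theorem cos_deg_le {δ : ℝ} (hδ : δ ≤ 90) : cos (δ * π / 180) ≤ (90 - δ) * 3.1416 / 180 := by
  rw [← sin_pi_div_two_sub]
  refine (sin_le (by nlinarith [pi_pos])).trans ?_
  nlinarith [pi_lt_d4]

open Real in
theorem cos_far_le : cos (123.5 * π / 180) ≤ -0.5418 := by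
  have h := sin_ge_sub_cube (x := 33.5 * π / 180) (by positivity)
  rw [show 123.5 * π / 180 = 33.5 * π / 180 + π / 2 by ring, cos_add_pi_div_two]
  have h₁ : (0.5846 : ℝ) ≤ 33.5 * π / 180 := by linarith [pi_gt_d4]
  have h₂ : 33.5 * π / 180 ≤ (0.585 : ℝ) := by linarith [pi_lt_d4]
  have h₃ : (33.5 * π / 180) ^ 3 ≤ (0.585 : ℝ) ^ 3 := by gcongr
  norm_num at h₃ ⊢
  norm_num at h h₁
  linarith

/-- The angles of the five-point instance, in degrees. -/
noncomputable def fiveAngle : Fin 5 → ℝ := ![17.37, 96.22, 174.42, 219.75, 299.27]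

/-- Lower bounds, in units of `10⁻⁴`, for the pairwise distances of the five points. -/
def fiveDist : Fin 5 → Fin 5 → ℕ :=
  ![![0, 12660, 17560, 17560, 12580],
    ![12660, 0, 12580, 17560, 17560],
    ![17560, 12580, 0, 7650, 17560],
    ![17560, 17560, 7650, 0, 12660],
    ![12580, 17560, 17560, 12660, 0]]

theorem fiveDist_le (i j : Fin 5) :
    (fiveDist i j : ℝ) / 10000 ≤
      dist (unitCirclePtDeg (fiveAngle i)) (unitCirclePtDeg (fiveAngle j)) := by
  have hcos : Real.cos (45 * Real.pi / 180) ≤ 0.7072 := by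
    rw [show 45 * Real.pi / 180 = Real.pi / 4 by ring, Real.cos_pi_div_four]
    nlinarith [Real.sq_sqrt (show (0 : ℝ) ≤ 2 by norm_num), Real.sqrt_nonneg 2]
  wlog hij : i ≤ j generalizing i j
  · rw [dist_comm, show fiveDist i j = fiveDist j i by revert i j; decide]
    exact this j i (le_of_not_ge hij)
  have near₁ := cos_deg_le (δ := 78.85) (by norm_num)
  have near₂ := cos_deg_le (δ := 78.1) (by norm_num)
  fin_cases i <;> fin_cases j <;> first
    | exact absurd hij (by decide)
    | (simp [fiveDist]; done)
    | (refine le_unitCirclePtDeg_dist (by norm_num) ?_ ?_ near₁ ?_ <;>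
        norm_num [fiveAngle, fiveDist] <;> done)
    | (refine le_unitCirclePtDeg_dist (by norm_num) ?_ ?_ near₂ ?_ <;>
        norm_num [fiveAngle, fiveDist] <;> done)
    | (refine le_unitCirclePtDeg_dist (by norm_num) ?_ ?_ hcos ?_ <;>
        norm_num [fiveAngle, fiveDist] <;> done)
    | (refine le_unitCirclePtDeg_dist (by norm_num) ?_ ?_ cos_far_le ?_ <;>
        norm_num [fiveAngle, fiveDist])

theorem fiveDist_pos {i j : Fin 5} (h : i ≠ j) : 0 < fiveDist i j := by
  revert i j; decide

theorem fiveAngle_pt_injective : Function.Injective fun i => unitCirclePtDeg (fiveAngle i) := by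
  intro i j h
  by_contra hij
  have h₁ := fiveDist_le i j
  have h₂ : (0 : ℝ) < fiveDist i j := by exact_mod_cast fiveDist_pos hij
  simp only at h
  rw [h, dist_self] at h₁
  linarith

theorem mem_fivePointInstance {p : EuclideanSpace ℝ (Fin 2)} :
    p ∈ fivePointInstance ↔ ∃ i, unitCirclePtDeg (fiveAngle i) = p := by
  simp [fivePointInstance, Fin.exists_fin_succ, fiveAngle, eq_comm]

/-- A path with two edges between the five points that is short enough contains the edge
joining the third and the fourth point. -/
theorem two_edges_of_fiveDist_lt {i j k : Fin 5} (hij : i ≠ j) (hjk : j ≠ k) (hik : i ≠ k)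
    (h : fiveDist i j + fiveDist j k < 25200) :
    (i, j, k) = (1, 2, 3) ∨ (i, j, k) = (2, 3, 4) ∨ (i, j, k) = (3, 2, 1) ∨
      (i, j, k) = (4, 3, 2) := by
  revert i j k; decide

theorem le_fiveDist_three_edges {i j k l : Fin 5} (hij : i ≠ j) (hjk : j ≠ k) (hkl : k ≠ l)
    (hik : i ≠ k) (hjl : j ≠ l) :
    25200 ≤ fiveDist i j + fiveDist j k + fiveDist k l := by
  by_contra! h
  have h₁ := two_edges_of_fiveDist_lt hij hjk hik (by omega)
  have h₂ := two_edges_of_fiveDist_lt hjk hkl hjl (by omega)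
  simp only [Prod.mk.injEq] at h₁ h₂
  rcases h₁ with ⟨rfl, rfl, rfl⟩ | ⟨rfl, rfl, rfl⟩ | ⟨rfl, rfl, rfl⟩ | ⟨rfl, rfl, rfl⟩ <;>
    rcases h₂ with ⟨h₃, h₄, rfl⟩ | ⟨h₃, h₄, rfl⟩ | ⟨h₃, h₄, rfl⟩ | ⟨h₃, h₄, rfl⟩ <;>
    revert h h₃ h₄ <;> decide

theorem exists_three_ne (c g : Fin 5) :
    ∃ x y z : Fin 5, x ≠ y ∧ x ≠ z ∧ y ≠ z ∧ x ≠ c ∧ y ≠ c ∧ z ≠ c ∧ x ≠ g ∧ y ≠ g ∧ z ≠ g := by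
  revert c g; decide

/-- There is no wake-up tree with root child `c` and parent function `f` whose wake-up times `t`
all stay below `3.52`. -/
theorem five_no_short_tree (f : Fin 5 → Fin 5) (c : Fin 5) (t : Fin 5 → ℝ)
    (ht : ∀ i, 1 ≤ t i) (hlt : ∀ i, t i < 3.52) (hne : ∀ i, i ≠ c → f i ≠ i)
    (hstep : ∀ i, i ≠ c → t (f i) + (fiveDist (f i) i : ℝ) / 10000 ≤ t i)
    (hdeg : ∀ x y z, x ≠ c → y ≠ c → z ≠ c → f x = f y → f x = f z → x = y ∨ x = z ∨ y = z) :
    False := by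
  have hmono : ∀ i, i ≠ c → t (f i) < t i := by
    intro i hi
    have h₁ : (0 : ℝ) < fiveDist (f i) i := by exact_mod_cast fiveDist_pos (hne i hi)
    linarith [hstep i hi]
  have hne₂ : ∀ i, i ≠ c → f i ≠ c → f (f i) ≠ i := by
    intro i hi hj h
    have h₁ := hmono _ hj
    rw [h] at h₁
    linarith [hmono i hi]
  have htwo : ∀ i, i ≠ c → f i ≠ c → fiveDist (f (f i)) (f i) + fiveDist (f i) i < 25200 := by
    intro i hi hj
    have h : (fiveDist (f (f i)) (f i) : ℝ) + fiveDist (f i) i < 25200 := by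
      linarith [hstep i hi, hstep _ hj, ht (f (f i)), hlt i]
    exact_mod_cast h
  have hthree : ∀ i, i ≠ c → f i ≠ c → f (f i) = c := by
    intro i hi hj
    by_contra hk
    have h : (fiveDist (f (f (f i))) (f (f i)) : ℝ) + fiveDist (f (f i)) (f i) +
        fiveDist (f i) i < 25200 := by
      linarith [hstep i hi, hstep _ hj, hstep _ hk, ht (f (f (f i))), hlt i]
    have h' := le_fiveDist_three_edges (hne _ hk) (hne _ hj) (hne _ hi) (hne₂ _ hj hk)
      (hne₂ _ hi hj)
    have h'' : fiveDist (f (f (f i))) (f (f i)) + fiveDist (f (f i)) (f i) +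
        fiveDist (f i) i < 25200 := by exact_mod_cast h
    omega
  have huniq : ∀ i j, i ≠ c → f i ≠ c → j ≠ c → f j ≠ c → i = j := by
    intro i j hi hi' hj hj'
    have h₁ := two_edges_of_fiveDist_lt (hne _ hi') (hne _ hi) (hne₂ _ hi hi') (htwo i hi hi')
    have h₂ := two_edges_of_fiveDist_lt (hne _ hj') (hne _ hj) (hne₂ _ hj hj') (htwo j hj hj')
    rw [hthree i hi hi'] at h₁
    rw [hthree j hj hj'] at h₂
    simp only [Prod.mk.injEq] at h₁ h₂
    omega
  obtain ⟨g, hg⟩ : ∃ g, ∀ i, i ≠ c → i ≠ g → f i = c := by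
    by_cases h : ∃ g, g ≠ c ∧ f g ≠ c
    · obtain ⟨g, hgc, hfg⟩ := h
      exact ⟨g, fun i hi hig => by_contra fun hfi => hig (huniq i g hi hfi hgc hfg)⟩
    · push Not at h
      exact ⟨c, fun i hi _ => h i hi⟩
  obtain ⟨x, y, z, hxy, hxz, hyz, hx, hy, hz, hx', hy', hz'⟩ := exists_three_ne c g
  rcases hdeg x y z hx hy hz (by rw [hg x hx hx', hg y hy hy'])
    (by rw [hg x hx hx', hg z hz hz']) with h | h | h <;> contradiction

/-- every wake-up tree rooted at the origin for the five-point instance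
with polar angles `17.37°, 96.22°, 174.42°, 219.75°, 299.27°` on the unit circle has
makespan at least `3.52`. -/
theorem fivePointInstance_makespan_ge
    (parent : EuclideanSpace ℝ (Fin 2) → EuclideanSpace ℝ (Fin 2))
    (t : EuclideanSpace ℝ (Fin 2) → ℝ)
    (h : IsWakeUpTree dist (0 : EuclideanSpace ℝ (Fin 2)) fivePointInstance parent t) :
    ∃ p, (p = (0 : EuclideanSpace ℝ (Fin 2)) ∨ p ∈ fivePointInstance) ∧ 3.52 ≤ t p := by
  obtain ⟨ht₀, hpar, huniq, hroot, hdeg⟩ := h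
  by_contra! hlt
  set P : Fin 5 → EuclideanSpace ℝ (Fin 2) := fun i => unitCirclePtDeg (fiveAngle i) with hP
  have hmem : ∀ i, P i ∈ fivePointInstance := fun i => mem_fivePointInstance.2 ⟨i, rfl⟩
  have hP₀ : ∀ i, P i ≠ 0 := fun i => unitCirclePtDeg_ne_zero _
  have hone : ∀ n : ℕ, ∀ i, parent^[n] (P i) = 0 → 1 ≤ t (P i) := by
    intro n
    induction n with
    | zero => exact fun i hi => absurd hi (hP₀ i)
    | succ n ih =>
      intro i hi
      obtain ⟨hp, hti, -⟩ := hpar _ (hmem i) (hP₀ i)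
      rcases hp with hp | hp
      · rw [hti, hp, ht₀, unitCirclePtDeg_dist_zero, zero_add]
      · obtain ⟨j, hj⟩ := mem_fivePointInstance.1 hp
        rw [Function.iterate_succ_apply, ← hj] at hi
        rw [hti, ← hj]
        exact (ih j hi).trans (le_add_of_nonneg_right dist_nonneg)
  obtain ⟨_, hcmem, -, hc₀⟩ := hroot ⟨P 0, hmem 0, hP₀ 0⟩
  obtain ⟨c, rfl⟩ := mem_fivePointInstance.1 hcmem
  have hf : ∀ i, ∃ j, i ≠ c → parent (P i) = P j := by
    intro i
    rcases (hpar _ (hmem i) (hP₀ i)).1 with hp | hp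
    · exact ⟨c, fun hi => absurd (fiveAngle_pt_injective
        (huniq _ (hmem i) (hP₀ i) hp _ (hmem c) (hP₀ c) hc₀)) hi⟩
    · obtain ⟨j, hj⟩ := mem_fivePointInstance.1 hp
      exact ⟨j, fun _ => hj.symm⟩
  choose f hf using hf
  refine five_no_short_tree f c (fun i => t (P i)) ?_ (fun i => hlt _ (Or.inr (hmem i))) ?_ ?_ ?_
  · intro i
    obtain ⟨n, hn⟩ := (hpar _ (hmem i) (hP₀ i)).2.2
    exact hone n i hn
  · intro i hi hfi
    obtain ⟨n, hn⟩ := (hpar _ (hmem i) (hP₀ i)).2.2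
    have hfix : parent (P i) = P i := by rw [hf i hi, hfi]
    rw [Function.iterate_fixed hfix] at hn
    exact hP₀ i hn
  · intro i hi
    have hti := (hpar _ (hmem i) (hP₀ i)).2.1
    rw [hf i hi] at hti
    rw [hti]
    exact add_le_add_right (fiveDist_le _ _) _
  · intro x y z hx hy hz hxy hxz
    have := hdeg (P (f x)) (hmem _) (hP₀ _) _ (hmem x) _ (hmem y) _ (hmem z) (hP₀ x) (hP₀ y)
      (hP₀ z) (hf x hx) (by rw [hf y hy, hxy]) (by rw [hf z hz, hxz])
    exact this.imp (fun e => fiveAngle_pt_injective e)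
      (Or.imp (fun e => fiveAngle_pt_injective e) fun e => fiveAngle_pt_injective e)
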